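/- Let (e_n)_{n≥1} be the standard orthonormal basis of ℓ² and for each n ≥ 1 let P_n ∈ B(ℓ²) be the orthogonal projection onto span{e_1, …, e_n}. Let B be the unital C*-algebra of all bounded sequences (T_n) with T_n ∈ P_n B(ℓ²) P_n for every n that converge in the *-strong operator topology to some T ∈ B(ℓ²), and let π : B → B(ℓ²) be the surjective unital *-homomorphism π((T_n)) = (*-SOT)-lim_n T_n. Then for a separable C*-algebra A the following are equivalent: (1) A is RFD; (2) for every unital *-homomorphism ρ : A⁺ → B(ℓ²) there exists a unital *-homomorphism τ : A⁺ → B with π ∘ τ = ρ. -/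

import Mathlib

/- STATEMENT 12: Theorem 3: a separable C*-algebra is RFD iff every unital representation
of its unitization on `ℓ²` lifts through the *-SOT limit map `π : B → B(ℓ²)`, where `B` is
the algebra of *-SOT convergent sequences `(T_n)` with `T_n ∈ P_n B(ℓ²) P_n`.  A lift
`τ : A⁺ → B` with `π ∘ τ = ρ` is recorded through its coordinates: a sequence of
*-homomorphisms `τ_n : A⁺ → P_n B(ℓ²) P_n` with `τ_n(1) = P_n` (so that `τ` is unital)
and `τ_n(a) → ρ(a)` in the *-strong operator topology (so that `(τ_n(a))_n ∈ B` and
`π(τ(a)) = ρ(a)`). -/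

open Filter Topology

universe u

/-- The Hilbert space `ℓ²` of square-summable complex sequences. -/
noncomputable abbrev ell2 : Type := lp (fun _ : ℕ => ℂ) 2

/-- A sequence of operators converges in the *-strong operator topology to `T₀`. -/
def SOTStarTendsto {H : Type*} [NormedAddCommGroup H] [InnerProductSpace ℂ H]
    [CompleteSpace H] (T : ℕ → H →L[ℂ] H) (T₀ : H →L[ℂ] H) : Prop :=
  ∀ x : H, Tendsto (fun n => T n x) atTop (𝓝 (T₀ x)) ∧
    Tendsto (fun n => star (T n) x) atTop (𝓝 (star T₀ x))

/-- A C*-algebra is residually finite-dimensional (RFD) if its representations on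
finite-dimensional complex Hilbert spaces separate its points. -/
def IsRFD (A : Type u) [NonUnitalCStarAlgebra A] : Prop :=
  ∀ a : A, a ≠ 0 →
    ∃ (H : Type u) (_ : NormedAddCommGroup H) (_ : InnerProductSpace ℂ H)
      (_ : FiniteDimensional ℂ H) (π : A →⋆ₙₐ[ℂ] (H →L[ℂ] H)), π a ≠ 0

universe v w

section MatrixAction

variable {B : Type u} [CStarAlgebra B] {ι : Type*} [Fintype ι]
  {H : Type v} [NormedAddCommGroup H] [InnerProductSpace ℂ H] [CompleteSpace H]

/-- The action of a matrix over `B` on families of vectors induced by a representation of `B`. -/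
noncomputable def matrixAct (σ : B →⋆ₐ[ℂ] (H →L[ℂ] H)) (T : CStarMatrix ι ι B) (η : ι → H) : ι → H :=
  fun i => ∑ j, σ (T i j) (η j)

/-- The sesquilinear form on families of vectors given by a matrix over `B`. -/
noncomputable def matrixForm (σ : B →⋆ₐ[ℂ] (H →L[ℂ] H)) (T : CStarMatrix ι ι B) (η ζ : ι → H) : ℂ :=
  ∑ i, inner ℂ (η i) (matrixAct σ T ζ i)

variable (σ : B →⋆ₐ[ℂ] (H →L[ℂ] H))

lemma matrixAct_mul (S T : CStarMatrix ι ι B) (η : ι → H) :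
    matrixAct σ (S * T) η = matrixAct σ S (matrixAct σ T η) := by
  ext i
  simp only [matrixAct, CStarMatrix.mul_apply, map_sum, map_mul, sum_apply,
    mul_apply_eq_comp]
  exact Finset.sum_comm

lemma matrixForm_star_mul (S T : CStarMatrix ι ι B) (η ζ : ι → H) :
    matrixForm σ (star S * T) η ζ = matrixForm σ T (matrixAct σ S η) ζ := by
  rw [matrixForm, matrixForm, matrixAct_mul]
  simp only [matrixAct, CStarMatrix.star_apply, map_star, inner_sum, sum_inner,
    ContinuousLinearMap.star_eq_adjoint, ContinuousLinearMap.adjoint_inner_right]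
  refine Finset.sum_comm.trans (Finset.sum_congr rfl fun i _ => Finset.sum_comm)

lemma matrixForm_mul (S T : CStarMatrix ι ι B) (η ζ : ι → H) :
    matrixForm σ (S * T) η ζ = matrixForm σ S η (matrixAct σ T ζ) := by
  rw [matrixForm, matrixForm, matrixAct_mul]

lemma matrixForm_sub (S T : CStarMatrix ι ι B) (η ζ : ι → H) :
    matrixForm σ (S - T) η ζ = matrixForm σ S η ζ - matrixForm σ T η ζ := by
  simp [matrixForm, matrixAct, Finset.sum_sub_distrib]

lemma matrixForm_add (S T : CStarMatrix ι ι B) (η ζ : ι → H) :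
    matrixForm σ (S + T) η ζ = matrixForm σ S η ζ + matrixForm σ T η ζ := by
  simp [matrixForm, matrixAct, Finset.sum_add_distrib]

lemma matrixForm_star (T : CStarMatrix ι ι B) (η ζ : ι → H) :
    matrixForm σ (star T) η ζ = star (matrixForm σ T ζ η) := by
  simp only [matrixForm, matrixAct, CStarMatrix.star_apply, map_star, inner_sum, star_sum,
    ContinuousLinearMap.star_eq_adjoint, ContinuousLinearMap.adjoint_inner_right]
  rw [Finset.sum_comm]
  simp

lemma matrixForm_star_mul_self (T : CStarMatrix ι ι B) (η : ι → H) :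
    matrixForm σ (star T * T) η η = ((∑ i, ‖matrixAct σ T η i‖ ^ 2 : ℝ) : ℂ) := by
  rw [matrixForm_star_mul, matrixForm]
  simp [inner_self_eq_norm_sq_to_K]

lemma map_eq_zero_of_matrixAct_eq_zero [DecidableEq ι] {T : CStarMatrix ι ι B}
    (h : ∀ η : ι → H, matrixAct σ T η = 0) (i j : ι) : σ (T i j) = 0 := by
  ext x
  have := congrFun (h (Pi.single j x)) i
  rw [matrixAct, Finset.sum_eq_single j] at this
  · simpa using this
  · intro k _ hk
    simp [Pi.single_eq_of_ne hk]
  · simp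

end MatrixAction

lemma IsSelfAdjoint.exists_star_mul_self_sub {C : Type*} [CStarAlgebra C] {T : C}
    (hT : IsSelfAdjoint T) :
    ∃ X Y : C, IsSelfAdjoint X ∧ IsSelfAdjoint Y ∧ T = X * X - Y * Y ∧ X * Y = 0 := by
  refine ⟨cfc (fun x : ℝ => √x) T, cfc (fun x : ℝ => √(-x)) T, cfc_predicate _ _,
    cfc_predicate _ _, ?_, ?_⟩
  · rw [← cfc_mul _ _ T, ← cfc_mul _ _ T, ← cfc_sub _ _ T]
    conv_lhs => rw [← cfc_id ℝ T]
    refine cfc_congr fun x _ => ?_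
    rcases le_total 0 x with h | h
    · simp [Real.mul_self_sqrt h, Real.sqrt_eq_zero_of_nonpos (neg_nonpos.2 h)]
    · simp [Real.mul_self_sqrt (neg_nonneg.2 h), Real.sqrt_eq_zero_of_nonpos h]
  · rw [← cfc_mul _ _ T, ← cfc_zero ℝ T]
    refine cfc_congr fun x _ => ?_
    rcases le_total 0 x with h | h
    · simp [Real.sqrt_eq_zero_of_nonpos (neg_nonpos.2 h)]
    · simp [Real.sqrt_eq_zero_of_nonpos h]

/-- The finite-dimensional unital representations of `B` separate its points. -/
def FinDimSeparated (B : Type u) [CStarAlgebra B] : Prop :=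
  ∀ b : B, b ≠ 0 →
    ∃ (H : Type u) (_ : NormedAddCommGroup H) (_ : InnerProductSpace ℂ H)
      (_ : FiniteDimensional ℂ H) (σ : B →⋆ₐ[ℂ] (H →L[ℂ] H)), σ b ≠ 0

lemma FinDimSeparated.matrixForm_nonneg {B : Type u} [CStarAlgebra B] (hB : FinDimSeparated B)
    {ι : Type*} [Fintype ι] {T : CStarMatrix ι ι B} (hT : IsSelfAdjoint T)
    (hpos : ∀ (H : Type u) [NormedAddCommGroup H] [InnerProductSpace ℂ H] [FiniteDimensional ℂ H]
      (σ : B →⋆ₐ[ℂ] (H →L[ℂ] H)) (η : ι → H), 0 ≤ (matrixForm σ T η η).re)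
    {K : Type v} [NormedAddCommGroup K] [InnerProductSpace ℂ K] [CompleteSpace K]
    (ρ : B →⋆ₐ[ℂ] (K →L[ℂ] K)) (ξ : ι → K) : 0 ≤ (matrixForm ρ T ξ ξ).re := by
  classical
  let _ : PartialOrder B := CStarAlgebra.spectralOrder B
  have _ : StarOrderedRing B := CStarAlgebra.spectralOrderedRing B
  obtain ⟨X, Y, hX, hY, hXY, h0⟩ :=
    IsSelfAdjoint.exists_star_mul_self_sub (C := CStarMatrix ι ι B) hT
  have hYX : Y * X = 0 := by simpa [hX.star_eq, hY.star_eq] using congrArg star h0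
  have hYTY : star Y * T * Y = - (star (Y * Y) * (Y * Y)) := by
    rw [star_mul, hY.star_eq, hXY, mul_sub, ← mul_assoc Y X X, hYX]
    simp [mul_assoc]
  have hYY : Y * Y = 0 := by
    ext i j
    by_contra hne
    obtain ⟨H, _, _, _, σ, hσ⟩ := hB _ hne
    refine hσ (map_eq_zero_of_matrixAct_eq_zero σ (fun η => ?_) i j)
    have h1 := hpos H σ (matrixAct σ Y η)
    rw [← matrixForm_star_mul, ← matrixForm_mul, hYTY, ← zero_sub, matrixForm_sub,
      matrixForm_star_mul_self] at h1
    have h2 : matrixForm σ (0 : CStarMatrix ι ι B) η η = 0 := by simp [matrixForm, matrixAct]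
    rw [h2, zero_sub, Complex.neg_re, Complex.ofReal_re] at h1
    have h3 : ∑ i, ‖matrixAct σ (Y * Y) η i‖ ^ 2 = 0 :=
      le_antisymm (by linarith) (Finset.sum_nonneg fun _ _ => by positivity)
    rw [Finset.sum_eq_zero_iff_of_nonneg fun _ _ => by positivity] at h3
    ext k
    simpa using h3 k (Finset.mem_univ k)
  rw [hXY, hYY, sub_zero]
  nth_rewrite 1 [← hX.star_eq]
  rw [matrixForm_star_mul_self, Complex.ofReal_re]
  positivity

section DirectSum

variable {B : Type u} [CStarAlgebra B]
  {H : Type v} [NormedAddCommGroup H] [InnerProductSpace ℂ H] [CompleteSpace H]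
  {K : Type w} [NormedAddCommGroup K] [InnerProductSpace ℂ K] [CompleteSpace K]

/-- The direct sum of two representations. -/
noncomputable def directSumRep (σ : B →⋆ₐ[ℂ] (H →L[ℂ] H)) (τ : B →⋆ₐ[ℂ] (K →L[ℂ] K)) :
    B →⋆ₐ[ℂ] (WithLp 2 (H × K) →L[ℂ] WithLp 2 (H × K)) where
  toFun b := (WithLp.prodContinuousLinearEquiv 2 ℂ H K).symm.toContinuousLinearMap ∘L
    ((σ b).prodMap (τ b)) ∘L (WithLp.prodContinuousLinearEquiv 2 ℂ H K).toContinuousLinearMap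
  map_one' := by ext x; simp
  map_mul' a b := by ext x; simp [Prod.map]
  map_zero' := by ext x; simp [Prod.map]
  map_add' a b := by ext x; simp [Prod.map, ← WithLp.toLp_add]
  commutes' r := by ext x; simp [Algebra.algebraMap_eq_smul_one, Prod.map]; rfl
  map_star' b := by
    refine (ContinuousLinearMap.eq_adjoint_iff _ _).mpr fun x y => ?_
    simp [WithLp.prod_inner_apply, map_star σ, map_star τ, ContinuousLinearMap.star_eq_adjoint,
      ContinuousLinearMap.adjoint_inner_left]

lemma directSumRep_apply (σ : B →⋆ₐ[ℂ] (H →L[ℂ] H)) (τ : B →⋆ₐ[ℂ] (K →L[ℂ] K)) (b : B)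
    (x : WithLp 2 (H × K)) :
    directSumRep σ τ b x = WithLp.toLp 2 (σ b x.fst, τ b x.snd) := rfl

lemma inner_directSumRep (σ : B →⋆ₐ[ℂ] (H →L[ℂ] H)) (τ : B →⋆ₐ[ℂ] (K →L[ℂ] K)) (b : B)
    (x x' : H) (y y' : K) :
    inner ℂ (WithLp.toLp 2 (x, y)) (directSumRep σ τ b (WithLp.toLp 2 (x', y'))) =
      inner ℂ x (σ b x') + inner ℂ y (τ b y') := rfl

end DirectSum

section Approximation

variable {B : Type u} [CStarAlgebra B]

/-- The matrix coefficients of finite families of vectors in finite-dimensional representations. -/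
def finDimCoefficients (F : Finset B) (ι : Type*) : Set (ι × ι × F → ℂ) :=
  {s | ∃ (H : Type u) (_ : NormedAddCommGroup H) (_ : InnerProductSpace ℂ H)
      (_ : FiniteDimensional ℂ H) (σ : B →⋆ₐ[ℂ] (H →L[ℂ] H)) (η : ι → H),
      ∀ x, s x = inner ℂ (η x.1) (σ x.2.2 (η x.2.1))}

lemma add_mem_finDimCoefficients {F : Finset B} {ι : Type*} {s t : ι × ι × F → ℂ}
    (hs : s ∈ finDimCoefficients F ι) (ht : t ∈ finDimCoefficients F ι) :
    s + t ∈ finDimCoefficients F ι := by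
  obtain ⟨H, _, _, _, σ, η, hs⟩ := hs
  obtain ⟨K, _, _, _, τ, ζ, ht⟩ := ht
  refine ⟨WithLp 2 (H × K), inferInstance, inferInstance, inferInstance, directSumRep σ τ,
    fun i => WithLp.toLp 2 (η i, ζ i), fun x => ?_⟩
  simp [directSumRep_apply, WithLp.prod_inner_apply, hs, ht]

lemma smul_mem_finDimCoefficients {F : Finset B} {ι : Type*} {s : ι × ι × F → ℂ}
    (hs : s ∈ finDimCoefficients F ι) {r : ℝ} (hr : 0 ≤ r) :
    r • s ∈ finDimCoefficients F ι := by
  obtain ⟨H, _, _, _, σ, η, hs⟩ := hs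
  refine ⟨H, _, _, inferInstance, σ, fun i => ((√r : ℝ) : ℂ) • η i, fun x => ?_⟩
  simp only [Pi.smul_apply, hs, map_smul, inner_smul_left, inner_smul_right, Complex.conj_ofReal,
    ← mul_assoc, ← Complex.ofReal_mul, Real.mul_self_sqrt hr, Complex.real_smul]

lemma zero_mem_finDimCoefficients (F : Finset B) (ι : Type*) :
    0 ∈ finDimCoefficients F ι :=
  ⟨PUnit, inferInstance, inferInstance, inferInstance, {
    toFun := fun _ => 0
    map_one' := Subsingleton.elim _ _
    map_mul' := fun _ _ => Subsingleton.elim _ _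
    map_zero' := Subsingleton.elim _ _
    map_add' := fun _ _ => Subsingleton.elim _ _
    commutes' := fun _ => Subsingleton.elim _ _
    map_star' := fun _ => Subsingleton.elim _ _ }, 0, by simp⟩

lemma convex_finDimCoefficients (F : Finset B) (ι : Type*) :
    Convex ℝ (finDimCoefficients F ι) := fun _ hs _ ht _ _ ha hb _ =>
  add_mem_finDimCoefficients (smul_mem_finDimCoefficients hs ha) (smul_mem_finDimCoefficients ht hb)

lemma matrixForm_linearCombination {F : Finset B} {ι : Type*} [Fintype ι] {H : Type v}
    [NormedAddCommGroup H] [InnerProductSpace ℂ H] [CompleteSpace H]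
    (σ : B →⋆ₐ[ℂ] (H →L[ℂ] H)) (c : ι × ι × F → ℂ) (η : ι → H) :
    matrixForm σ (CStarMatrix.ofMatrix fun i j => ∑ b, c (i, j, b) • (b : B)) η η =
      ∑ x, c x * inner ℂ (η x.1) (σ x.2.2 (η x.2.1)) := by
  have hσ : ∀ i j, σ ((CStarMatrix.ofMatrix fun i j => ∑ b, c (i, j, b) • (b : B) :
      CStarMatrix ι ι B) i j) (η j) = ∑ b, c (i, j, b) • σ b (η j) := by
    intro i j
    change σ (∑ b, c (i, j, b) • (b : B)) (η j) = _
    simp [map_sum]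
  simp only [matrixForm, matrixAct, hσ, inner_sum, inner_smul_right, Fintype.sum_prod_type]

lemma FinDimSeparated.mem_closure_finDimCoefficients (hB : FinDimSeparated B) (F : Finset B)
    {ι : Type*} [Fintype ι] {K : Type v} [NormedAddCommGroup K] [InnerProductSpace ℂ K]
    [CompleteSpace K] (ρ : B →⋆ₐ[ℂ] (K →L[ℂ] K)) (ξ : ι → K) :
    (fun x : ι × ι × F => inner ℂ (ξ x.1) (ρ x.2.2 (ξ x.2.1))) ∈
      closure (finDimCoefficients F ι) := by
  classical
  by_contra hmem
  obtain ⟨f, u, hlt, hgt⟩ := RCLike.geometric_hahn_banach_point_closed (𝕜 := ℂ)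
    (convex_finDimCoefficients F ι).closure isClosed_closure hmem
  have hu : u < 0 := by
    simpa using hgt 0 (subset_closure (zero_mem_finDimCoefficients F ι))
  have hnonneg : ∀ s ∈ finDimCoefficients F ι, 0 ≤ (f s).re := by
    intro s hs
    by_contra! hneg
    have := hgt _ (subset_closure (smul_mem_finDimCoefficients hs
      (div_nonneg_of_nonpos hu.le hneg.le)))
    rw [← Complex.coe_smul, map_smul] at this
    simp [div_mul_cancel₀ _ hneg.ne] at this
  set c : ι × ι × F → ℂ := fun x => f (Pi.single x 1)
  have hf : ∀ s, f s = ∑ x, c x * s x := by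
    intro s
    conv_lhs => rw [← Finset.univ_sum_single s]
    rw [map_sum]
    refine Finset.sum_congr rfl fun x _ => ?_
    rw [mul_comm, ← smul_eq_mul, ← map_smul]
    congr 1
    ext y
    simp [Pi.single_apply]
  set T : CStarMatrix ι ι B := CStarMatrix.ofMatrix fun i j => ∑ b, c (i, j, b) • (b : B)
  have key := hB.matrixForm_nonneg (T := T + star T) (IsSelfAdjoint.add_star_self T) ?_ ρ ξ
  · rw [matrixForm_add, matrixForm_star] at key
    rw [hf, ← matrixForm_linearCombination ρ c ξ] at hlt
    simp only [RCLike.re_to_complex, Complex.add_re, Complex.star_def, Complex.conj_re] at hlt key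
    linarith
  · intro H _ _ _ σ η
    have := hnonneg _ ⟨H, _, _, inferInstance, σ, η, fun _ => rfl⟩
    rw [hf, ← matrixForm_linearCombination σ c η] at this
    rw [matrixForm_add, matrixForm_star]
    simp only [Complex.add_re, Complex.star_def, Complex.conj_re]
    linarith

end Approximation

section Orthonormalization

open scoped ComplexOrder in
lemma Matrix.PosSemidef.exists_gram_eq {ι : Type*} [Fintype ι] {M : Matrix ι ι ℂ}
    (hM : M.PosSemidef) :
    ∃ ζ : ι → EuclideanSpace ℂ ι, Matrix.gram ℂ ζ = M := by
  classical
  open scoped MatrixOrder Matrix.Norms.L2Operator in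
  obtain ⟨X, hX⟩ := CStarAlgebra.nonneg_iff_eq_star_mul_self.1 hM.nonneg
  refine ⟨fun i => WithLp.toLp 2 (fun k => X k i), ?_⟩
  ext i j
  rw [hX]
  simp [Matrix.gram_apply, Matrix.mul_apply, Matrix.star_apply, PiLp.inner_apply, mul_comm]

variable {ι : Type*} [Fintype ι] [DecidableEq ι]

open scoped ComplexOrder in
lemma posSemidef_one_sub_smul_gram {H : Type*} [NormedAddCommGroup H] [InnerProductSpace ℂ H]
    (η : ι → H) {δ : ℝ} (hδ : 0 ≤ δ)
    (h : ∀ i j, ‖Matrix.gram ℂ η i j - (1 : Matrix ι ι ℂ) i j‖ ≤ δ) :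
    (1 - ((1 + Fintype.card ι * δ)⁻¹ : ℝ) • Matrix.gram ℂ η).PosSemidef := by
  have hpos : 0 < 1 + Fintype.card ι * δ := by positivity
  refine .of_dotProduct_mulVec_nonneg (.sub Matrix.isHermitian_one ?_) fun x => ?_
  · rw [Matrix.IsHermitian, Matrix.conjTranspose_smul, (Matrix.isHermitian_gram ℂ η).eq,
      star_trivial]
  have h1 : star x ⬝ᵥ (Matrix.gram ℂ η).mulVec x = ((‖∑ i, x i • η i‖ ^ 2 : ℝ) : ℂ) := by
    rw [Matrix.star_dotProduct_gram_mulVec, inner_self_eq_norm_sq_to_K]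
    simp
  have h2 : star x ⬝ᵥ x = ((∑ i, ‖x i‖ ^ 2 : ℝ) : ℂ) := by
    simp [dotProduct, Complex.conj_mul']
  have h3 : ‖∑ i, x i • η i‖ ^ 2 - ∑ i, ‖x i‖ ^ 2 ≤ δ * (∑ i, ‖x i‖) ^ 2 := by
    have h4 : ((‖∑ i, x i • η i‖ ^ 2 - ∑ i, ‖x i‖ ^ 2 : ℝ) : ℂ) =
        ∑ i, ∑ j, star (x i) * (Matrix.gram ℂ η i j - (1 : Matrix ι ι ℂ) i j) * x j := by
      rw [Complex.ofReal_sub, ← h1, ← h2]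
      rw [show star x ⬝ᵥ x = star x ⬝ᵥ (1 : Matrix ι ι ℂ).mulVec x by rw [Matrix.one_mulVec],
        ← dotProduct_sub, ← Matrix.sub_mulVec]
      simp [dotProduct, Matrix.mulVec, Finset.mul_sum, mul_assoc]
    calc _ ≤ ‖((‖∑ i, x i • η i‖ ^ 2 - ∑ i, ‖x i‖ ^ 2 : ℝ) : ℂ)‖ := by
          rw [Complex.norm_real]; exact le_abs_self _
      _ ≤ ∑ i, ∑ j, ‖x i‖ * δ * ‖x j‖ := by
          rw [h4]
          refine (norm_sum_le _ _).trans (Finset.sum_le_sum fun i _ =>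
            (norm_sum_le _ _).trans (Finset.sum_le_sum fun j _ => ?_))
          rw [norm_mul, norm_mul, norm_star]
          gcongr
          exact h i j
      _ = δ * (∑ i, ‖x i‖) ^ 2 := by
          rw [sq, Finset.sum_mul_sum, Finset.mul_sum]
          refine Finset.sum_congr rfl fun i _ => ?_
          rw [Finset.mul_sum]
          exact Finset.sum_congr rfl fun j _ => by ring
  have h5 : (∑ i, ‖x i‖) ^ 2 ≤ Fintype.card ι * ∑ i, ‖x i‖ ^ 2 := by
    simpa using sq_sum_le_card_mul_sum_sq (s := Finset.univ) (f := fun i => ‖x i‖)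
  rw [Matrix.sub_mulVec, dotProduct_sub, Matrix.one_mulVec, Matrix.smul_mulVec, dotProduct_smul,
    h1, h2, Complex.real_smul, ← Complex.ofReal_mul, ← Complex.ofReal_sub]
  rw [Complex.zero_le_real, sub_nonneg, inv_mul_le_iff₀ hpos]
  nlinarith [mul_le_mul_of_nonneg_left h5 hδ]

variable {B : Type u} [CStarAlgebra B]

/-- The representation on `H` by scalar operators given by a character. -/
noncomputable def scalarRep (χ : B →⋆ₐ[ℂ] ℂ) (H : Type*) [NormedAddCommGroup H]
    [InnerProductSpace ℂ H] [CompleteSpace H] : B →⋆ₐ[ℂ] (H →L[ℂ] H) :=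
  (StarAlgHom.ofId ℂ (H →L[ℂ] H)).comp χ

lemma scalarRep_apply (χ : B →⋆ₐ[ℂ] ℂ) {H : Type*} [NormedAddCommGroup H]
    [InnerProductSpace ℂ H] [CompleteSpace H] (b : B) (x : H) :
    scalarRep χ H b x = χ b • x := by
  simp [scalarRep, Algebra.algebraMap_eq_smul_one]

lemma exists_orthonormal_coefficients (χ : B →⋆ₐ[ℂ] ℂ) {H : Type u} [NormedAddCommGroup H]
    [InnerProductSpace ℂ H] [FiniteDimensional ℂ H] (σ : B →⋆ₐ[ℂ] (H →L[ℂ] H)) {m : ℕ}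
    (η : Fin m → H) {δ : ℝ} (hδ : 0 ≤ δ)
    (h : ∀ i j, ‖Matrix.gram ℂ η i j - (1 : Matrix (Fin m) (Fin m) ℂ) i j‖ ≤ δ) :
    ∃ (K : Type u) (_ : NormedAddCommGroup K) (_ : InnerProductSpace ℂ K)
      (_ : FiniteDimensional ℂ K) (τ : B →⋆ₐ[ℂ] (K →L[ℂ] K)) (ζ : Fin m → K),
      Orthonormal ℂ ζ ∧ ∀ b i j, inner ℂ (ζ i) (τ b (ζ j)) =
        ((1 + m * δ)⁻¹ : ℝ) * inner ℂ (η i) (σ b (η j)) +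
          χ b * ((1 : Matrix (Fin m) (Fin m) ℂ) i j - ((1 + m * δ)⁻¹ : ℝ) * inner ℂ (η i) (η j)) := by
  obtain ⟨ζ, hζ⟩ := (posSemidef_one_sub_smul_gram η hδ h).exists_gram_eq
  have hζ' : ∀ i j, inner ℂ (ζ i) (ζ j) = (1 : Matrix (Fin m) (Fin m) ℂ) i j -
      ((1 + m * δ)⁻¹ : ℝ) * inner ℂ (η i) (η j) := by
    intro i j
    have := congrFun (congrFun hζ i) j
    simpa [Matrix.gram_apply] using this
  set r : ℝ := (1 + m * δ)⁻¹
  have hr : 0 ≤ r := by positivity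
  let e := LinearIsometryEquiv.piLpCongrLeft 2 ℂ ℂ (Equiv.ulift.{u} (α := Fin m)).symm
  have hcoef : ∀ b i j, inner ℂ (WithLp.toLp 2 (((√r : ℝ) : ℂ) • η i, e (ζ i)))
      (directSumRep σ (scalarRep χ (EuclideanSpace ℂ (ULift.{u} (Fin m)))) b
        (WithLp.toLp 2 (((√r : ℝ) : ℂ) • η j, e (ζ j)))) =
      r * inner ℂ (η i) (σ b (η j)) + χ b * ((1 : Matrix (Fin m) (Fin m) ℂ) i j -
        r * inner ℂ (η i) (η j)) := by
    intro b i j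
    rw [inner_directSumRep]
    simp only [scalarRep_apply, map_smul, inner_smul_left, inner_smul_right, Complex.conj_ofReal,
      ← mul_assoc, ← Complex.ofReal_mul, Real.mul_self_sqrt hr, LinearIsometryEquiv.inner_map_map,
      hζ']
  refine ⟨WithLp 2 (H × EuclideanSpace ℂ (ULift.{u} (Fin m))), inferInstance, inferInstance,
    inferInstance, directSumRep σ (scalarRep χ _),
    fun i => WithLp.toLp 2 (((√r : ℝ) : ℂ) • η i, e (ζ i)), ?_, hcoef⟩
  rw [← Matrix.gram_eq_one_iff_orthonormal]
  ext i j
  rw [Matrix.gram_apply]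
  simpa using hcoef 1 i j

lemma FinDimSeparated.exists_orthonormal_approx (hB : FinDimSeparated B) (χ : B →⋆ₐ[ℂ] ℂ)
    (F : Finset B) {m : ℕ} {K : Type v} [NormedAddCommGroup K] [InnerProductSpace ℂ K]
    [CompleteSpace K] (ρ : B →⋆ₐ[ℂ] (K →L[ℂ] K)) {ξ : Fin m → K} (hξ : Orthonormal ℂ ξ)
    {ε : ℝ} (hε : 0 < ε) :
    ∃ (H : Type u) (_ : NormedAddCommGroup H) (_ : InnerProductSpace ℂ H)
      (_ : FiniteDimensional ℂ H) (σ : B →⋆ₐ[ℂ] (H →L[ℂ] H)) (η : Fin m → H),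
      Orthonormal ℂ η ∧ ∀ b ∈ F, ∀ i j,
        ‖inner ℂ (η i) (σ b (η j)) - inner ℂ (ξ i) (ρ b (ξ j))‖ < ε := by
  classical
  obtain ⟨s, hs, hlim⟩ := mem_closure_iff_seq_limit.1
    (hB.mem_closure_finDimCoefficients (insert 1 F) ρ ξ)
  set p : Fin m × Fin m × (insert 1 F : Finset B) → ℂ :=
    fun x => inner ℂ (ξ x.1) (ρ x.2.2 (ξ x.2.1))
  let o : (insert 1 F : Finset B) := ⟨1, by simp⟩
  have hp : ∀ i j, p (i, j, o) = (1 : Matrix (Fin m) (Fin m) ℂ) i j := by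
    intro i j
    rw [← Matrix.gram_eq_one_iff_orthonormal.2 hξ, Matrix.gram_apply]
    simp [p, o]
  have hr : Tendsto (fun k => (((1 + m * ‖s k - p‖)⁻¹ : ℝ) : ℂ)) atTop (𝓝 1) := by
    have h1 : Tendsto (fun k => (1 + m * ‖s k - p‖)⁻¹) atTop (𝓝 (1 + m * 0)⁻¹) := by
      refine Tendsto.inv₀ (tendsto_const_nhds.add (tendsto_const_nhds.mul ?_)) (by simp)
      exact tendsto_iff_norm_sub_tendsto_zero.1 hlim
    rw [mul_zero, add_zero, inv_one] at h1
    have h2 := (Complex.continuous_ofReal.tendsto 1).comp h1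
    rw [Complex.ofReal_one] at h2
    exact h2
  have hcoord : ∀ x, Tendsto (fun k => s k x) atTop (𝓝 (p x)) := tendsto_pi_nhds.1 hlim
  have hev : ∀ᶠ k in atTop, ∀ x : Fin m × Fin m × (insert 1 F : Finset B),
      ‖((((1 + m * ‖s k - p‖)⁻¹ : ℝ) : ℂ) * s k x + χ x.2.2 * ((1 : Matrix (Fin m) (Fin m) ℂ)
        x.1 x.2.1 - ((1 + m * ‖s k - p‖)⁻¹ : ℝ) * s k (x.1, x.2.1, o))) - p x‖ < ε := by
    refine eventually_all.2 fun x => ?_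
    have h2 := (hr.mul (hcoord x)).add ((tendsto_const_nhds (x := χ x.2.2)).mul
      ((tendsto_const_nhds (x := (1 : Matrix (Fin m) (Fin m) ℂ) x.1 x.2.1)).sub
        (hr.mul (hcoord (x.1, x.2.1, o)))))
    rw [hp, one_mul, one_mul, sub_self, mul_zero, add_zero] at h2
    simpa [dist_eq_norm] using Metric.tendsto_nhds.1 h2 ε hε
  obtain ⟨k, hk⟩ := hev.exists
  obtain ⟨H, _, _, _, σ, η, hη⟩ := hs k
  have hgram : ∀ i j, inner ℂ (η i) (η j) = s k (i, j, o) := by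
    intro i j
    rw [hη]
    simp [o]
  obtain ⟨H', i1, i2, i3, σ', η', hon, hη'⟩ := exists_orthonormal_coefficients χ σ η
    (norm_nonneg (s k - p)) fun i j => by
      rw [Matrix.gram_apply, hgram, ← hp]
      exact norm_le_pi_norm (s k - p) (i, j, o)
  refine ⟨H', i1, i2, i3, σ', η', hon, fun b hb i j => ?_⟩
  have := hk (i, j, ⟨b, Finset.mem_insert_of_mem hb⟩)
  rw [hη] at this
  rw [hη', hgram]
  exact this

end Orthonormalization

section Truncation

/-- The standard Hilbert basis of `ℓ²`. -/
noncomputable def stdBasis : HilbertBasis ℕ ℂ ell2 :=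
  HilbertBasis.ofRepr (LinearIsometryEquiv.refl ℂ ell2)

lemma inner_stdBasis (i : ℕ) (x : ell2) : inner ℂ (stdBasis i) x = (x : ℕ → ℂ) i := by
  rw [← HilbertBasis.repr_apply_apply]
  rfl

open ContinuousLinearMap in
lemma OrthonormalBasis.exists_adjoint_comp_eq_one {H : Type*} [NormedAddCommGroup H]
    [InnerProductSpace ℂ H] [CompleteSpace H] {n : ℕ} (b : OrthonormalBasis (Fin n) ℂ H)
    {P : ell2 →L[ℂ] ell2}
    (hP : ∀ (x : ell2) (i : ℕ), (P x : ℕ → ℂ) i = if i < n then (x : ℕ → ℂ) i else 0) :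
    ∃ J : H →L[ℂ] ell2, adjoint J ∘L J = 1 ∧ J ∘L adjoint J = P ∧ ∀ i, J (b i) = stdBasis i := by
  let J : H →L[ℂ] ell2 := ∑ i : Fin n, (innerSL ℂ (b i)).smulRight (stdBasis i)
  let G : ell2 →L[ℂ] H := ∑ i : Fin n, (innerSL ℂ (stdBasis i)).smulRight (b i)
  have hJ : ∀ x, J x = ∑ i : Fin n, inner ℂ (b i) x • stdBasis i := fun x => by
    simp [J, sum_apply]
  have hG : ∀ x, G x = ∑ i : Fin n, inner ℂ (stdBasis i) x • b i := fun x => by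
    simp [G, sum_apply]
  have hJb : ∀ i, J (b i) = stdBasis i := fun i => by
    rw [hJ, Finset.sum_eq_single i]
    · simp
    · intro j _ hj
      simp [b.inner_eq_zero hj]
    · simp
  have hadj : G = adjoint J := by
    refine (eq_adjoint_iff _ _).2 fun x y => ?_
    simp only [hG, hJ, sum_inner, inner_sum, inner_smul_left, inner_smul_right, inner_conj_symm]
    exact Finset.sum_congr rfl fun i _ => mul_comm _ _
  refine ⟨J, ?_, ?_, hJb⟩
  · rw [← hadj]
    ext x
    rw [comp_apply, hG, one_apply_eq_self]
    conv_rhs => rw [← b.sum_repr' x]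
    refine Finset.sum_congr rfl fun i _ => ?_
    rw [← adjoint_inner_left, ← hadj, hG]
    rw [Finset.sum_eq_single i]
    · simp [stdBasis.orthonormal.1]
    · intro j _ hj
      rw [stdBasis.orthonormal.2 fun h => hj (Fin.ext h), zero_smul]
    · simp
  · rw [← hadj]
    ext x k
    rw [hP, comp_apply, hG, map_sum]
    simp only [map_smul, hJb, ← inner_stdBasis k, inner_sum, inner_smul_right]
    split_ifs with hk
    · rw [Finset.sum_eq_single ⟨k, hk⟩]
      · simp [stdBasis.orthonormal.1]
      · intro j _ hj
        rw [stdBasis.orthonormal.2 fun h => hj (Fin.ext h.symm), mul_zero]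
      · simp
    · refine Finset.sum_eq_zero fun j _ => ?_
      rw [stdBasis.orthonormal.2 fun h : k = j => hk (h ▸ j.2), mul_zero]

end Truncation

section Compression

open ContinuousLinearMap

variable {B : Type u} [CStarAlgebra B]
  {H : Type v} [NormedAddCommGroup H] [InnerProductSpace ℂ H] [CompleteSpace H]
  {K : Type w} [NormedAddCommGroup K] [InnerProductSpace ℂ K] [CompleteSpace K]

/-- The representation on `K` obtained from a representation on `H` and an isometry `J` of `H`
into `K`, vanishing on the orthogonal complement of the range of `J`. -/
noncomputable def extendRep (J : H →L[ℂ] K) (hJ : adjoint J ∘L J = 1)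
    (σ : B →⋆ₐ[ℂ] (H →L[ℂ] H)) : B →⋆ₙₐ[ℂ] (K →L[ℂ] K) where
  toFun b := J ∘L σ b ∘L adjoint J
  map_smul' c b := by simp
  map_zero' := by simp
  map_add' a b := by simp
  map_mul' a b := by
    ext x
    have h : ∀ y, adjoint J (J y) = y := fun y => DFunLike.congr_fun hJ y
    simp [h]
  map_star' b := by
    rw [map_star, star_eq_adjoint, star_eq_adjoint, adjoint_comp, adjoint_comp, adjoint_adjoint,
      comp_assoc]

lemma extendRep_apply (J : H →L[ℂ] K) (hJ : adjoint J ∘L J = 1) (σ : B →⋆ₐ[ℂ] (H →L[ℂ] H))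
    (b : B) : extendRep J hJ σ b = J ∘L σ b ∘L adjoint J := rfl

lemma extendRep_one (J : H →L[ℂ] K) (hJ : adjoint J ∘L J = 1) (σ : B →⋆ₐ[ℂ] (H →L[ℂ] H)) :
    extendRep J hJ σ 1 = J ∘L adjoint J := by
  ext x
  simp [extendRep_apply]

lemma inner_extendRep (J : H →L[ℂ] K) (hJ : adjoint J ∘L J = 1) (σ : B →⋆ₐ[ℂ] (H →L[ℂ] H))
    (b : B) (x y : H) : inner ℂ (J x) (extendRep J hJ σ b (J y)) = inner ℂ x (σ b y) := by
  have h : ∀ y, adjoint J (J y) = y := fun y => DFunLike.congr_fun hJ y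
  simp [extendRep_apply, h, ← adjoint_inner_right]

end Compression

section TruncatedRepresentation

variable {B : Type u} [CStarAlgebra B]

lemma map_one_mul_map_mul_map_one {R : Type*} [NonUnitalSemiring R] [Star R]
    [DistribMulAction ℂ R] (τ : B →⋆ₙₐ[ℂ] R) (b : B) : τ 1 * τ b * τ 1 = τ b := by
  rw [← map_mul, ← map_mul, one_mul, mul_one]

lemma exists_map_one_eq {H : Type v} [NormedAddCommGroup H] [InnerProductSpace ℂ H]
    [CompleteSpace H] (σ : B →⋆ₐ[ℂ] (H →L[ℂ] H)) {n : ℕ} (b : OrthonormalBasis (Fin n) ℂ H)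
    {P : ell2 →L[ℂ] ell2}
    (hP : ∀ (x : ell2) (i : ℕ), (P x : ℕ → ℂ) i = if i < n then (x : ℕ → ℂ) i else 0) :
    ∃ τ : B →⋆ₙₐ[ℂ] (ell2 →L[ℂ] ell2), τ 1 = P ∧ ∀ (a : B) (i j : Fin n),
      inner ℂ (stdBasis i) (τ a (stdBasis j)) = inner ℂ (b i) (σ a (b j)) := by
  obtain ⟨J, hJ, hJP, hJb⟩ := b.exists_adjoint_comp_eq_one hP
  refine ⟨extendRep J hJ σ, (extendRep_one J hJ σ).trans hJP, fun a i j => ?_⟩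
  rw [← hJb, ← hJb, inner_extendRep]

lemma exists_orthonormalBasis_of_finrank_le (χ : B →⋆ₐ[ℂ] ℂ) {H : Type u} [NormedAddCommGroup H]
    [InnerProductSpace ℂ H] [FiniteDimensional ℂ H] (σ : B →⋆ₐ[ℂ] (H →L[ℂ] H)) {m n : ℕ}
    (hn : Module.finrank ℂ H ≤ n) (hmn : m ≤ n) {η : Fin m → H} (hη : Orthonormal ℂ η) :
    ∃ (K : Type u) (_ : NormedAddCommGroup K) (_ : InnerProductSpace ℂ K)
      (_ : FiniteDimensional ℂ K) (τ : B →⋆ₐ[ℂ] (K →L[ℂ] K)) (b : OrthonormalBasis (Fin n) ℂ K),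
      ∀ (a : B) (i j : Fin m), inner ℂ (b (i.castLE hmn)) (τ a (b (j.castLE hmn))) =
        inner ℂ (η i) (σ a (η j)) := by
  let L := EuclideanSpace ℂ (ULift.{u} (Fin (n - Module.finrank ℂ H)))
  let v : Fin n → WithLp 2 (H × L) := fun i =>
    if h : i < m then WithLp.toLp 2 (η ⟨i, h⟩, 0) else 0
  have hcard : Module.finrank ℂ (WithLp 2 (H × L)) = Fintype.card (Fin n) := by
    rw [(WithLp.linearEquiv 2 ℂ (H × L)).finrank_eq, Module.finrank_prod]
    simp [L]
    omega
  have hv : Orthonormal ℂ (({i : Fin n | (i : ℕ) < m}).domRestrict v) := by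
    have h : Orthonormal ℂ fun i => (WithLp.toLp 2 (η i, 0) : WithLp 2 (H × L)) := by
      classical
      rw [orthonormal_iff_ite] at hη ⊢
      intro i j
      simp [WithLp.prod_inner_apply, hη]
    convert! h.comp (fun i : {i : Fin n | (i : ℕ) < m} => ⟨i, i.2⟩)
      (fun i j hij => Subtype.ext (Fin.ext (Fin.mk.inj hij))) using 1
    ext1 i
    exact dif_pos i.2
  obtain ⟨b, hb⟩ := hv.exists_orthonormalBasis_extension_of_card_eq hcard
  refine ⟨WithLp 2 (H × L), inferInstance, inferInstance, inferInstance,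
    directSumRep σ (scalarRep χ L), b, fun a i j => ?_⟩
  rw [hb _ (by simp), hb _ (by simp)]
  simp only [v, Fin.val_castLE, Fin.is_lt, dif_pos]
  rw [inner_directSumRep, inner_zero_left, add_zero]

lemma FinDimSeparated.eventually_exists_approx (hB : FinDimSeparated B) (χ : B →⋆ₐ[ℂ] ℂ)
    (ρ : B →⋆ₐ[ℂ] (ell2 →L[ℂ] ell2)) {P : ℕ → (ell2 →L[ℂ] ell2)}
    (hP : ∀ (n : ℕ) (x : ell2) (i : ℕ),
      (P n x : ℕ → ℂ) i = if i < n then (x : ℕ → ℂ) i else 0)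
    (F : Finset B) (m : ℕ) {ε : ℝ} (hε : 0 < ε) :
    ∀ᶠ n in atTop, ∃ τ : B →⋆ₙₐ[ℂ] (ell2 →L[ℂ] ell2), τ 1 = P n ∧
      ∀ b ∈ F, ∀ i < m, ∀ j < m, ‖inner ℂ (stdBasis i) (τ b (stdBasis j)) -
        inner ℂ (stdBasis i) (ρ b (stdBasis j))‖ < ε := by
  obtain ⟨H, _, _, _, σ, η, hη, happ⟩ := hB.exists_orthonormal_approx χ F ρ
    (stdBasis.orthonormal.comp ((↑) : Fin m → ℕ) Fin.val_injective) hε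
  filter_upwards [eventually_ge_atTop (max m (Module.finrank ℂ H))] with n hn
  have hmn := (le_max_left _ _).trans hn
  obtain ⟨K, _, _, _, σ', b, hb⟩ :=
    exists_orthonormalBasis_of_finrank_le χ σ ((le_max_right _ _).trans hn) hmn hη
  obtain ⟨τ, hτ1, hτ⟩ := exists_map_one_eq σ' b (hP n)
  refine ⟨τ, hτ1, fun a ha i hi j hj => ?_⟩
  have := happ a ha ⟨i, hi⟩ ⟨j, hj⟩
  rw [← hb _ _ _, ← hτ] at this
  exact this

end TruncatedRepresentation

section Convergence

lemma exists_tendsto_atTop_of_eventually {Q : ℕ → ℕ → Prop} (h0 : ∀ n, Q 0 n)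
    (hQ : ∀ k, ∀ᶠ n in atTop, Q k n) :
    ∃ κ : ℕ → ℕ, Tendsto κ atTop atTop ∧ ∀ n, Q (κ n) n := by
  classical
  refine ⟨fun n => Nat.findGreatest (fun k => Q k n) n, tendsto_atTop.2 fun k => ?_, fun n => ?_⟩
  · filter_upwards [hQ k, eventually_ge_atTop k] with n hn hkn
    exact Nat.le_findGreatest hkn hn
  · exact Nat.findGreatest_spec (P := fun k => Q k n) (Nat.zero_le n) (h0 n)

lemma tendsto_of_mem_closure_of_lipschitz {E : Type*} [SeminormedAddCommGroup E]
    {f : ℕ → E → ℂ} {g : E → ℂ} {C : ℝ} (hC : 0 ≤ C)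
    (hf : ∀ n x y, ‖f n x - f n y‖ ≤ C * ‖x - y‖) (hg : Continuous g) {s : Set E}
    (hs : ∀ x ∈ s, Tendsto (fun n => f n x) atTop (𝓝 (g x))) {x : E} (hx : x ∈ closure s) :
    Tendsto (fun n => f n x) atTop (𝓝 (g x)) := by
  have h : Equicontinuous f := (LipschitzWith.uniformEquicontinuous f ⟨C, hC⟩ fun n =>
    LipschitzWith.of_dist_le_mul fun x y => by
      simpa only [dist_eq_norm] using! hf n x y).equicontinuous
  exact closure_minimal hs (h.isClosed_setOfPred_tendsto hg) hx

variable {B : Type u} [CStarAlgebra B]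
  {H : Type v} [NormedAddCommGroup H] [InnerProductSpace ℂ H] [CompleteSpace H]

lemma tendsto_apply_of_tendsto_inner {τ : ℕ → (B →⋆ₙₐ[ℂ] (H →L[ℂ] H))}
    {ρ : B →⋆ₙₐ[ℂ] (H →L[ℂ] H)}
    (h : ∀ b x y, Tendsto (fun n => inner ℂ x (τ n b y)) atTop (𝓝 (inner ℂ x (ρ b y))))
    (b : B) (x : H) : Tendsto (fun n => τ n b x) atTop (𝓝 (ρ b x)) := by
  have key : ∀ σ : B →⋆ₙₐ[ℂ] (H →L[ℂ] H),
      ‖σ b x‖ ^ 2 = (inner ℂ x (σ (star b * b) x) : ℂ).re := fun σ => by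
    rw [map_mul, map_star, ContinuousLinearMap.star_eq_adjoint, mul_apply_eq_comp,
      ContinuousLinearMap.adjoint_inner_right]
    exact norm_sq_eq_re_inner (𝕜 := ℂ) _
  have h1 : Tendsto (fun n => ‖τ n b x - ρ b x‖ ^ 2) atTop (𝓝 (‖ρ b x‖ ^ 2 -
      2 * (inner ℂ (ρ b x) (ρ b x) : ℂ).re + ‖ρ b x‖ ^ 2)) := by
    have h2 : ∀ n, ‖τ n b x - ρ b x‖ ^ 2 = (inner ℂ x (τ n (star b * b) x) : ℂ).re -
        2 * (inner ℂ (ρ b x) (τ n b x) : ℂ).re + ‖ρ b x‖ ^ 2 := fun n => by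
      rw [norm_sub_sq (𝕜 := ℂ), ← key, inner_re_symm]
      rfl
    simp only [h2]
    rw [key]
    exact (((Complex.continuous_re.tendsto _).comp (h (star b * b) x x)).sub
      (((Complex.continuous_re.tendsto _).comp (h b (ρ b x) x)).const_mul 2)).add_const _
  have h3 : (inner ℂ (ρ b x) (ρ b x) : ℂ).re = ‖ρ b x‖ ^ 2 :=
    (norm_sq_eq_re_inner (𝕜 := ℂ) _).symm
  rw [h3, show ‖ρ b x‖ ^ 2 - 2 * ‖ρ b x‖ ^ 2 + ‖ρ b x‖ ^ 2 = 0 by ring] at h1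
  rw [tendsto_iff_norm_sub_tendsto_zero]
  simpa using h1.sqrt

lemma SOTStarTendsto.of_tendsto_inner {τ : ℕ → (B →⋆ₙₐ[ℂ] (H →L[ℂ] H))}
    {ρ : B →⋆ₙₐ[ℂ] (H →L[ℂ] H)}
    (h : ∀ b x y, Tendsto (fun n => inner ℂ x (τ n b y)) atTop (𝓝 (inner ℂ x (ρ b y)))) (b : B) :
    SOTStarTendsto (fun n => τ n b) (ρ b) := by
  refine fun x => ⟨tendsto_apply_of_tendsto_inner h b x, ?_⟩
  simp only [← map_star]
  exact tendsto_apply_of_tendsto_inner h (star b) x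

lemma norm_inner_map_le (σ : B →⋆ₙₐ[ℂ] (H →L[ℂ] H)) (b : B) (x y : H) :
    ‖(inner ℂ x (σ b y) : ℂ)‖ ≤ ‖x‖ * ‖b‖ * ‖y‖ := by
  refine (norm_inner_le_norm _ _).trans ?_
  rw [mul_assoc]
  gcongr
  exact (σ b).le_of_opNorm_le (NonUnitalStarAlgHom.norm_apply_le σ b) y

lemma tendsto_inner_of_dense {τ : ℕ → (B →⋆ₙₐ[ℂ] (H →L[ℂ] H))} {ρ : B →⋆ₙₐ[ℂ] (H →L[ℂ] H)}
    {ι : Type*} (e : HilbertBasis ι ℂ H) {s : Set B} (hs : Dense s)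
    (h : ∀ b ∈ s, ∀ i j, Tendsto (fun n => inner ℂ (e i) (τ n b (e j))) atTop
      (𝓝 (inner ℂ (e i) (ρ b (e j))))) (b : B) (x y : H) :
    Tendsto (fun n => inner ℂ x (τ n b y)) atTop (𝓝 (inner ℂ x (ρ b y))) := by
  have hdense : ∀ z : H, z ∈ closure (Submodule.span ℂ (Set.range e) : Set H) := fun z => by
    rw [← Submodule.topologicalClosure_coe, e.dense_span]
    trivial
  have hb : ∀ b i j, Tendsto (fun n => inner ℂ (e i) (τ n b (e j))) atTop
      (𝓝 (inner ℂ (e i) (ρ b (e j)))) := by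
    intro b i j
    have hlip : ∀ (σ : B →⋆ₙₐ[ℂ] (H →L[ℂ] H)) (a c : B), ‖(inner ℂ (e i) (σ a (e j)) : ℂ) -
        inner ℂ (e i) (σ c (e j))‖ ≤ (‖e i‖ * ‖e j‖) * ‖a - c‖ := fun σ a c => by
      rw [← inner_sub_right, ← sub_apply, ← map_sub, mul_right_comm]
      exact norm_inner_map_le σ _ _ _
    refine tendsto_of_mem_closure_of_lipschitz (f := fun n b => inner ℂ (e i) (τ n b (e j)))
      (g := fun b => inner ℂ (e i) (ρ b (e j))) (by positivity) (fun n => hlip (τ n)) ?_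
      (fun b hb => h b hb i j) (hs b)
    exact (LipschitzWith.of_dist_le_mul (K := ⟨‖e i‖ * ‖e j‖, by positivity⟩) fun a c => by
      simpa only [dist_eq_norm] using! hlip ρ a c).continuous
  have hy : ∀ i y, Tendsto (fun n => inner ℂ (e i) (τ n b y)) atTop
      (𝓝 (inner ℂ (e i) (ρ b y))) := by
    intro i y
    refine tendsto_of_mem_closure_of_lipschitz (f := fun n y => inner ℂ (e i) (τ n b y))
      (g := fun y => inner ℂ (e i) (ρ b y)) (C := ‖e i‖ * ‖b‖) (by positivity) (fun n y z => ?_)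
      (by fun_prop) (fun z hz => ?_) (hdense y)
    · rw [← inner_sub_right, ← map_sub]
      exact norm_inner_map_le _ _ _ _
    · induction hz using Submodule.span_induction with
      | mem z hz => obtain ⟨j, rfl⟩ := hz; exact hb b i j
      | zero => simp
      | add z w _ _ hz hw => simpa only [map_add, inner_add_right] using hz.add hw
      | smul c z _ hz => simpa only [map_smul, inner_smul_right] using hz.const_mul c
  refine tendsto_of_mem_closure_of_lipschitz (f := fun n x => inner ℂ x (τ n b y))
    (g := fun x => inner ℂ x (ρ b y)) (C := ‖b‖ * ‖y‖) (by positivity) (fun n x z => ?_)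
    (by fun_prop) (fun z hz => ?_) (hdense x)
  · rw [← inner_sub_left, mul_comm, ← mul_assoc]
    exact norm_inner_map_le _ _ _ _
  · induction hz using Submodule.span_induction with
    | mem z hz => obtain ⟨j, rfl⟩ := hz; exact hy j y
    | zero => simp
    | add z w _ _ hz hw => simpa only [inner_add_left] using hz.add hw
    | smul c z _ hz => simpa only [inner_smul_left] using hz.const_mul (starRingEnd ℂ c)

theorem FinDimSeparated.exists_lift [TopologicalSpace.SeparableSpace B] (hB : FinDimSeparated B)
    (χ : B →⋆ₐ[ℂ] ℂ) (ρ : B →⋆ₐ[ℂ] (ell2 →L[ℂ] ell2)) {P : ℕ → (ell2 →L[ℂ] ell2)}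
    (hP : ∀ (n : ℕ) (x : ell2) (i : ℕ),
      (P n x : ℕ → ℂ) i = if i < n then (x : ℕ → ℂ) i else 0) :
    ∃ τ : ℕ → (B →⋆ₙₐ[ℂ] (ell2 →L[ℂ] ell2)), (∀ n, τ n 1 = P n) ∧
      ∀ b, SOTStarTendsto (fun n => τ n b) (ρ b) := by
  classical
  let d := TopologicalSpace.denseSeq B
  obtain ⟨κ, hκ, hQ⟩ := exists_tendsto_atTop_of_eventually
    (Q := fun k n => ∃ τ : B →⋆ₙₐ[ℂ] (ell2 →L[ℂ] ell2), τ 1 = P n ∧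
      ∀ l < k, ∀ i < k, ∀ j < k, ‖inner ℂ (stdBasis i) (τ (d l) (stdBasis j)) -
        inner ℂ (stdBasis i) (ρ (d l) (stdBasis j))‖ < 1 / ((k : ℝ) + 1))
    (fun n => by
      obtain ⟨τ, hτ, -⟩ := exists_map_one_eq (scalarRep χ (EuclideanSpace ℂ (Fin n)))
        (EuclideanSpace.basisFun (Fin n) ℂ) (hP n)
      exact ⟨τ, hτ, by simp⟩)
    (fun k => by
      filter_upwards [hB.eventually_exists_approx χ ρ hP ((Finset.range k).image d) k
        (ε := 1 / ((k : ℝ) + 1)) (by positivity)] with n ⟨τ, hτ, h⟩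
      exact ⟨τ, hτ, fun l hl => h _ (Finset.mem_image_of_mem d (Finset.mem_range.2 hl))⟩)
  choose τ hτ1 hτ using hQ
  refine ⟨τ, hτ1, fun b => SOTStarTendsto.of_tendsto_inner (ρ := (ρ : B →⋆ₙₐ[ℂ] _))
    (tendsto_inner_of_dense stdBasis (TopologicalSpace.denseRange_denseSeq B) ?_) b⟩
  rintro _ ⟨l, rfl⟩ i j
  rw [tendsto_iff_norm_sub_tendsto_zero]
  refine squeeze_zero' (.of_forall fun _ => norm_nonneg _) ?_
    (tendsto_one_div_add_atTop_nhds_zero_nat.comp hκ)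
  filter_upwards [hκ.eventually_gt_atTop l, hκ.eventually_gt_atTop i,
    hκ.eventually_gt_atTop j] with n hl hi hj
  exact (hτ n l hl i hi j hj).le

end Convergence

section UnitizationFacts

variable (A : Type u) [NonUnitalCStarAlgebra A]

/-- The canonical character of the unitization of a C⋆-algebra. -/
noncomputable def unitizationCharacter : Unitization ℂ A →⋆ₐ[ℂ] ℂ where
  toAlgHom := Unitization.fstHom ℂ A
  map_star' x := Unitization.fst_star x

lemma unitizationCharacter_apply (b : Unitization ℂ A) : unitizationCharacter A b = b.fst := rfl

lemma separableSpace_unitization [TopologicalSpace.SeparableSpace A] :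
    TopologicalSpace.SeparableSpace (Unitization ℂ A) :=
  (Unitization.uniformEquivProd (𝕜 := ℂ) (A := A)).symm.surjective.denseRange.separableSpace
    (Unitization.uniformEquivProd (𝕜 := ℂ) (A := A)).symm.continuous

variable {A}

lemma IsRFD.finDimSeparated (hA : IsRFD A) : FinDimSeparated (Unitization ℂ A) := by
  intro b hb
  by_cases h : b.fst = 0
  · obtain ⟨a, rfl⟩ : ∃ a : A, b = a := ⟨b.snd, by ext <;> simp [h]⟩
    obtain ⟨H, _, _, _, π, hπ⟩ := hA a fun ha => hb (by rw [ha, Unitization.inr_zero])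
    have h1 : Unitization.starLift π a = π a :=
      DFunLike.congr_fun (Unitization.starLift.symm_apply_apply π) a
    exact ⟨H, _, _, inferInstance, Unitization.starLift π, h1 ▸ hπ⟩
  · refine ⟨EuclideanSpace ℂ (ULift.{u} (Fin 1)), _, _, inferInstance,
      scalarRep (unitizationCharacter A) _, fun h0 => h ?_⟩
    have := congrArg (fun x => x (ULift.up 0))
      (DFunLike.congr_fun h0 (EuclideanSpace.single (ULift.up 0) 1))
    simpa [scalarRep_apply, unitizationCharacter_apply] using this

end UnitizationFacts

section GNS

open scoped ComplexOrder

variable {B : Type u} [CStarAlgebra B]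

open ComplexStarModule in
lemma exists_positiveLinearMap_ne_zero [PartialOrder B] [StarOrderedRing B] {b : B}
    (hb : b ≠ 0) : ∃ f : B →ₚ[ℂ] ℂ, f (star b * b) ≠ 0 := by
  have hmem : -(star b * b) ∉ ProperCone.positive ℝ B := by
    rw [ProperCone.mem_positive, neg_nonneg]
    intro h
    exact hb (CStarRing.star_mul_self_eq_zero_iff _ |>.1 (le_antisymm h (star_mul_self_nonneg b)))
  obtain ⟨g, hg, hneg⟩ := ProperCone.hyperplane_separation_point _ hmem
  let g' : Module.Dual ℝ B := g.toLinearMap ∘ₗ (selfAdjoint.submodule ℝ B).subtype ∘ₗ realPart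
  have hg' : ∀ x, g' x = g (ℜ x : B) := fun x => rfl
  refine ⟨PositiveLinearMap.mk₀ (Module.Dual.extendRCLike (𝕜 := ℂ) g') fun x hx => ?_, ?_⟩
  · have hsa := IsSelfAdjoint.of_nonneg hx
    have := hg x hx
    rw [Module.Dual.extendRCLike_apply]
    simpa [hg', hsa.coe_realPart, hsa.imaginaryPart, realPart_I_smul] using this
  · intro h
    have h1 : (Module.Dual.extendRCLike (𝕜 := ℂ) g' (star b * b)).re = 0 := by
      rw [show Module.Dual.extendRCLike (𝕜 := ℂ) g' (star b * b) = 0 from h, Complex.zero_re]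
    have h2 := Module.Dual.re_extendRCLike_apply (𝕜 := ℂ) g' (star b * b)
    rw [hg', (IsSelfAdjoint.star_mul_self b).coe_realPart] at h2
    rw [map_neg] at hneg
    have h3 : g (star b * b) = 0 := h2.symm.trans h1
    linarith

lemma PositiveLinearMap.separableSpace_GNS [PartialOrder B] [StarOrderedRing B]
    [TopologicalSpace.SeparableSpace B] (f : B →ₚ[ℂ] ℂ) :
    TopologicalSpace.SeparableSpace f.GNS := by
  have hcont : Continuous f.toPreGNS := by
    obtain ⟨C, hC⟩ := f.exists_norm_apply_le
    refine AddMonoidHomClass.continuous_of_bound f.toPreGNS (√C) fun a => ?_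
    refine (sq_le_sq₀ (norm_nonneg _) (by positivity)).1 ?_
    rw [mul_pow, Real.sq_sqrt C.coe_nonneg, f.preGNS_norm_def, Real.sq_sqrt]
    · refine (Complex.re_le_norm _).trans ((hC _).trans_eq ?_)
      rw [f.ofPreGNS_toPreGNS, CStarRing.norm_star_mul_self, sq]
    · exact (Complex.nonneg_iff.1 (f.map_nonneg (star_mul_self_nonneg _))).1
  have : TopologicalSpace.SeparableSpace f.PreGNS :=
    f.toPreGNS.surjective.denseRange.separableSpace hcont
  infer_instance

lemma exists_separable_rep_ne_zero [TopologicalSpace.SeparableSpace B] {b : B} (hb : b ≠ 0) :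
    ∃ (H : Type u) (_ : NormedAddCommGroup H) (_ : InnerProductSpace ℂ H) (_ : CompleteSpace H)
      (_ : TopologicalSpace.SeparableSpace H) (σ : B →⋆ₐ[ℂ] (H →L[ℂ] H)), σ b ≠ 0 := by
  let _ : PartialOrder B := CStarAlgebra.spectralOrder B
  have _ : StarOrderedRing B := CStarAlgebra.spectralOrderedRing B
  obtain ⟨f, hf⟩ := exists_positiveLinearMap_ne_zero hb
  refine ⟨f.GNS, inferInstance, inferInstance, inferInstance, f.separableSpace_GNS,
    f.gnsStarAlgHom, fun h => hf ?_⟩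
  have h1 : f.gnsNonUnitalStarAlgHom b (f.toPreGNS 1 : f.GNS) = 0 := DFunLike.congr_fun h _
  rw [f.gnsNonUnitalStarAlgHom_apply_coe, f.leftMulMapPreGNS_apply] at h1
  have h2 := f.preGNS_norm_sq (f.toPreGNS b)
  rw [f.ofPreGNS_toPreGNS, mul_one] at h1
  rw [f.ofPreGNS_toPreGNS, ← UniformSpace.Completion.norm_coe, h1] at h2
  rw [← h2]
  simp

end GNS

section SeparableHilbert

lemma Orthonormal.countable {E : Type*} [NormedAddCommGroup E] [InnerProductSpace ℂ E]
    [TopologicalSpace.SeparableSpace E] {ι : Type*} {v : ι → E} (hv : Orthonormal ℂ v) :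
    Countable ι := by
  have hsq : ∀ i j, i ≠ j → ‖v i - v j‖ ^ 2 = 2 := fun i j hij => by
    rw [norm_sub_sq (𝕜 := ℂ), hv.1, hv.1, hv.2 hij]
    norm_num
  have hinj : Function.Injective v := hv.linearIndependent.injective
  have hdisc : DiscreteTopology (Set.range v) := by
    refine .of_forall_le_dist one_pos ?_
    rintro ⟨_, i, rfl⟩ ⟨_, j, rfl⟩ hij
    have := hsq i j fun h => hij (by simp [h])
    rw [Subtype.dist_eq, dist_eq_norm]
    nlinarith [norm_nonneg (v i - v j)]
  have hc : Countable (Set.range v) :=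
    TopologicalSpace.separableSpace_iff_countable.1 inferInstance
  exact (Equiv.ofInjective v hinj).countable_iff.2 hc

lemma exists_linearIsometryEquiv_ell2 (E : Type*) [NormedAddCommGroup E] [InnerProductSpace ℂ E]
    [CompleteSpace E] [TopologicalSpace.SeparableSpace E] (hE : ¬ FiniteDimensional ℂ E) :
    Nonempty (E ≃ₗᵢ[ℂ] ell2) := by
  obtain ⟨w, b, -⟩ := exists_hilbertBasis ℂ E
  have h1 : Countable w := b.orthonormal.countable
  have h2 : Infinite w := by
    by_contra h
    rw [not_infinite_iff_finite] at h
    have := Fintype.ofFinite w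
    exact hE b.toOrthonormalBasis.toBasis.finiteDimensional_of_finite
  obtain ⟨e⟩ : Nonempty (w ≃ ℕ) := nonempty_equiv_of_countable
  refine ⟨(HilbertBasis.mk (b.orthonormal.comp e.symm e.symm.injective) ?_).repr⟩
  rw [Set.range_comp, e.symm.range_eq_univ, Set.image_univ, b.dense_span]

end SeparableHilbert

section Converse

open ContinuousLinearMap

lemma separableSpace_ell2 : TopologicalSpace.SeparableSpace ell2 := by
  have h : TopologicalSpace.IsSeparable
      (closure (Submodule.span ℂ (Set.range stdBasis) : Set ell2)) :=
    ((Set.countable_range stdBasis).isSeparable.span (R := ℂ)).closure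
  rw [← Submodule.topologicalClosure_coe, stdBasis.dense_span] at h
  exact TopologicalSpace.isSeparable_univ_iff.1 h

lemma not_finiteDimensional_ell2 : ¬ FiniteDimensional ℂ ell2 := fun _ =>
  Infinite.not_finite (α := ℕ) stdBasis.orthonormal.linearIndependent.finite

variable {B : Type u} [CStarAlgebra B]

lemma exists_rep_ell2_ne_zero [TopologicalSpace.SeparableSpace B] (χ : B →⋆ₐ[ℂ] ℂ) {b : B}
    (hb : b ≠ 0) : ∃ ρ : B →⋆ₐ[ℂ] (ell2 →L[ℂ] ell2), ρ b ≠ 0 := by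
  obtain ⟨H, _, _, _, _, σ, hσ⟩ := exists_separable_rep_ne_zero hb
  have := separableSpace_ell2
  have hsep : TopologicalSpace.SeparableSpace (WithLp 2 (H × ell2)) :=
    (WithLp.prodContinuousLinearEquiv 2 ℂ H ell2).symm.surjective.denseRange.separableSpace
      (WithLp.prodContinuousLinearEquiv 2 ℂ H ell2).symm.continuous
  have hinf : ¬ FiniteDimensional ℂ (WithLp 2 (H × ell2)) := fun _ =>
    not_finiteDimensional_ell2 (Module.Finite.of_surjective
      (LinearMap.snd ℂ H ell2 ∘ₗ (WithLp.linearEquiv 2 ℂ (H × ell2)).toLinearMap)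
      (Prod.snd_surjective.comp (WithLp.linearEquiv 2 ℂ (H × ell2)).surjective))
  obtain ⟨e⟩ := exists_linearIsometryEquiv_ell2 _ hinf
  refine ⟨(e.conjStarAlgEquiv : _ →⋆ₐ[ℂ] _).comp (directSumRep σ (scalarRep χ ell2)),
    fun h => hσ ?_⟩
  have h1 : directSumRep σ (scalarRep χ ell2) b = 0 := by
    refine e.conjStarAlgEquiv.injective ?_
    rw [map_zero]
    exact h
  ext x
  exact congrArg WithLp.fst (DFunLike.congr_fun h1 (WithLp.toLp 2 (x, 0)))

variable {H : Type v} [NormedAddCommGroup H] [InnerProductSpace ℂ H] [CompleteSpace H]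
  {K : Type w} [NormedAddCommGroup K] [InnerProductSpace ℂ K] [CompleteSpace K]

/-- The restriction of a representation on `K` to its essential subspace, identified with `H`. -/
noncomputable def compressRep (J : H →L[ℂ] K) (τ : B →⋆ₙₐ[ℂ] (K →L[ℂ] K))
    (h : J ∘L adjoint J = τ 1) : B →⋆ₙₐ[ℂ] (H →L[ℂ] H) where
  toFun b := adjoint J ∘L τ b ∘L J
  map_smul' c b := by simp
  map_zero' := by simp
  map_add' a b := by simp
  map_mul' a b := by
    ext x
    have h' : ∀ y, J (adjoint J y) = τ 1 y := fun y => DFunLike.congr_fun h y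
    simp only [mul_apply_eq_comp, comp_apply, h']
    rw [← mul_apply_eq_comp (τ 1), ← map_mul, one_mul, map_mul, mul_apply_eq_comp]
  map_star' b := by
    rw [map_star, star_eq_adjoint, star_eq_adjoint, adjoint_comp, adjoint_comp, adjoint_adjoint,
      comp_assoc]

lemma compressRep_ne_zero (J : H →L[ℂ] K) (τ : B →⋆ₙₐ[ℂ] (K →L[ℂ] K))
    (h : J ∘L adjoint J = τ 1) {b : B} (hb : τ b ≠ 0) : compressRep J τ h b ≠ 0 := by
  intro h0
  have h1 : adjoint J ∘L τ b ∘L J = 0 := h0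
  refine hb ?_
  calc τ b = τ 1 * τ b * τ 1 := (map_one_mul_map_mul_map_one τ b).symm
    _ = J ∘L (adjoint J ∘L τ b ∘L J) ∘L adjoint J := by rw [← h]; rfl
    _ = 0 := by simp [h1]

lemma exists_finDim_rep_ne_zero {τ : B →⋆ₙₐ[ℂ] (ell2 →L[ℂ] ell2)} {n : ℕ}
    (hP : ∀ (x : ell2) (i : ℕ), (τ 1 x : ℕ → ℂ) i = if i < n then (x : ℕ → ℂ) i else 0) {b : B}
    (hb : τ b ≠ 0) :
    ∃ (H : Type u) (_ : NormedAddCommGroup H) (_ : InnerProductSpace ℂ H)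
      (_ : FiniteDimensional ℂ H) (π : B →⋆ₙₐ[ℂ] (H →L[ℂ] H)), π b ≠ 0 := by
  obtain ⟨J, -, hJ, -⟩ := ((EuclideanSpace.basisFun (ULift.{u} (Fin n)) ℂ).reindex
    Equiv.ulift).exists_adjoint_comp_eq_one hP
  exact ⟨_, _, _, inferInstance, compressRep J τ hJ, compressRep_ne_zero J τ hJ hb⟩

end Converse

theorem stmt_12 (A : Type u) [NonUnitalCStarAlgebra A]
    [TopologicalSpace.SeparableSpace A]
    -- `P n` is the orthogonal projection of `ℓ²` onto the span of the first `n` vectors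
    -- of the standard orthonormal basis:
    (P : ℕ → (ell2 →L[ℂ] ell2))
    (hP : ∀ (n : ℕ) (x : ell2) (i : ℕ),
      (P n x : ℕ → ℂ) i = if i < n then (x : ℕ → ℂ) i else 0) :
    IsRFD A ↔
      ∀ ρ : Unitization ℂ A →⋆ₐ[ℂ] (ell2 →L[ℂ] ell2),
        ∃ τ : ℕ → (Unitization ℂ A →⋆ₙₐ[ℂ] (ell2 →L[ℂ] ell2)),
          (∀ n, τ n 1 = P n) ∧
          (∀ (n : ℕ) (b : Unitization ℂ A), P n * τ n b * P n = τ n b) ∧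
          (∀ b : Unitization ℂ A, SOTStarTendsto (fun n => τ n b) (ρ b)) := by
  have := separableSpace_unitization A
  refine ⟨fun hA ρ => ?_, fun h a ha => ?_⟩
  · obtain ⟨τ, hτ1, hτ⟩ := hA.finDimSeparated.exists_lift (unitizationCharacter A) ρ hP
    refine ⟨τ, hτ1, fun n b => ?_, hτ⟩
    rw [← hτ1 n, map_one_mul_map_mul_map_one]
  · obtain ⟨ρ, hρ⟩ := exists_rep_ell2_ne_zero (unitizationCharacter A)
      (fun h0 => ha (Unitization.inr_injective (R := ℂ) h0) : (a : Unitization ℂ A) ≠ 0)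
    obtain ⟨τ, hτ1, -, hτ⟩ := h ρ
    obtain ⟨n, hn⟩ : ∃ n, τ n a ≠ 0 := by
      by_contra! h0
      refine hρ (ContinuousLinearMap.ext fun x => ?_)
      have := (hτ a x).1
      simp only [h0] at this
      exact tendsto_nhds_unique this tendsto_const_nhds
    obtain ⟨H, i1, i2, i3, π, hπ⟩ :=
      exists_finDim_rep_ne_zero (n := n) (by rw [hτ1 n]; exact hP n) hn
    exact ⟨H, i1, i2, i3, π.comp (Unitization.inrNonUnitalStarAlgHom ℂ A), hπ⟩
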